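/- arXiv:1612.07773 — 8 statements merged into one kernel-verified Lean document; each statement's English description precedes it below -/
import Mathlib

section
/- Let M be an additive commutative group, S a finite index set, K ⊆ S, and B any type. Suppose φ : (K → M) → B and ψ : B × ((S∖K) → M) → M satisfy ψ(φ(x∣K), x∣S∖K) = Σ_{s∈S} x(s) for every x : S → M. Then there exists h : B → M such that h(φ(y)) = Σ_{s∈K} y(s) for every y : K → M; i.e., the partial sum of the coordinates in K is determined by the value of φ. (This is Lemma 1 of the paper: a terminal connected to bottleneck edge e_k that can decode the total sum can in fact compute the partial sum Σ_{β∈A_k} X_β from the value carried on e_k alone.) -/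
/-- **Lemma 1.** Let `M` be an additive commutative group, `S` a finite index set, `K ⊆ S`
and `B` any type. If `φ : (K → M) → B` and `ψ : B × ((S∖K) → M) → M` are such that
`ψ (φ (x∣K), x∣S∖K) = ∑_{s ∈ S} x s` for every `x : S → M`, then the partial sum
`∑_{k ∈ K} y k` is determined by the value `φ y`: there is `h : B → M` with
`h (φ y) = ∑_{k ∈ K} y k` for all `y : K → M`. -/
theorem partial_sum_from_bottleneck {M : Type*} [AddCommGroup M] {S : Type*} [Fintype S]
    [DecidableEq S] (K : Finset S) {B : Type*}
    (φ : (↥K → M) → B) (ψ : B × (↥(Kᶜ) → M) → M)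
    (hψ : ∀ x : S → M, ψ (φ (fun k => x k.1), fun s => x s.1) = ∑ s, x s) :
    ∃ h : B → M, ∀ y : ↥K → M, h (φ y) = ∑ k, y k := by
  refine ⟨fun b => ψ (b, 0), fun y => ?_⟩
  have key := hψ fun s => if hs : s ∈ K then y ⟨s, hs⟩ else 0
  have hK : (fun k : ↥K => if hs : k.1 ∈ K then y ⟨k.1, hs⟩ else 0) = y := by
    funext k
    simp
  have hKc : (fun s : ↥(Kᶜ) => if hs : s.1 ∈ K then y ⟨s.1, hs⟩ else 0) = 0 := by
    funext s
    exact dif_neg (Finset.mem_compl.mp s.2)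
  rw [hK, hKc] at key
  beta_reduce
  rw [key, ← Finset.sum_subset (Finset.subset_univ K) fun s _ hs => dif_neg hs,
    ← Finset.sum_coe_sort K]
  exact Finset.sum_congr rfl fun k _ => congrFun hK k
end

section
/- Let M be an additive commutative group, S a finite index set, K₁, K₂ ⊆ S, and B₁, B₂ any types. Suppose φ₁ : (K₁ → M) → B₁, φ₂ : (K₂ → M) → B₂ and ψ : B₁ × B₂ × ((S∖(K₁∪K₂)) → M) → M satisfy ψ(φ₁(x∣K₁), φ₂(x∣K₂), x∣S∖(K₁∪K₂)) = Σ_{s∈S} x(s) for every x : S → M. Then there exists h : B₁ × B₂ → M such that h(φ₁(x∣K₁), φ₂(x∣K₂)) = Σ_{s∈K₁∪K₂} x(s) for every x : S → M. (This is Lemma 2 of the paper: a terminal t_e receiving the two bottleneck edges e_i and e_j can compute Σ_{β∈A_i∪A_j} X_β from their carried values.) -/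
/-- **Lemma 2.** Let `M` be an additive commutative group, `S` a finite index set,
`K₁, K₂ ⊆ S` and `B₁, B₂` any types. If `φ₁ : (K₁ → M) → B₁`, `φ₂ : (K₂ → M) → B₂` and
`ψ : B₁ × B₂ × ((S∖(K₁∪K₂)) → M) → M` satisfy
`ψ (φ₁ (x∣K₁), φ₂ (x∣K₂), x∣S∖(K₁∪K₂)) = ∑_{s ∈ S} x s` for every `x : S → M`, then there is
`h : B₁ × B₂ → M` with `h (φ₁ (x∣K₁), φ₂ (x∣K₂)) = ∑_{s ∈ K₁∪K₂} x s` for every `x`. -/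
theorem partial_sum_from_two_bottlenecks {M : Type*} [AddCommGroup M] {S : Type*} [Fintype S]
    [DecidableEq S] (K₁ K₂ : Finset S) {B₁ B₂ : Type*}
    (φ₁ : (↥K₁ → M) → B₁) (φ₂ : (↥K₂ → M) → B₂)
    (ψ : B₁ × B₂ × (↥((K₁ ∪ K₂)ᶜ) → M) → M)
    (hψ : ∀ x : S → M,
      ψ (φ₁ (fun k => x k.1), φ₂ (fun k => x k.1), fun s => x s.1) = ∑ s, x s) :
    ∃ h : B₁ × B₂ → M, ∀ x : S → M,
      h (φ₁ (fun k => x k.1), φ₂ (fun k => x k.1)) = ∑ s ∈ K₁ ∪ K₂, x s := by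
  refine ⟨fun b => ψ (b.1, b.2, 0), fun x => ?_⟩
  let y : S → M := fun s => if s ∈ K₁ ∪ K₂ then x s else 0
  have h₁ : (fun k : ↥K₁ => y k.1) = fun k => x k.1 :=
    funext fun k => if_pos (Finset.mem_union_left _ k.2)
  have h₂ : (fun k : ↥K₂ => y k.1) = fun k => x k.1 :=
    funext fun k => if_pos (Finset.mem_union_right _ k.2)
  have h₀ : (fun s : ↥((K₁ ∪ K₂)ᶜ) => y s.1) = 0 :=
    funext fun s => if_neg (Finset.mem_compl.mp s.2)
  have hy := hψ y
  rw [h₁, h₂, h₀] at hy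
  exact hy.trans (Fintype.sum_ite_mem (K₁ ∪ K₂) x)
end

section
/- Given a Construction-2 (r,l)-code of capacity α, for every edge e = {i,j} ∈ Ẽ there exists a function h_e : A^(αl) × A^(αl) → A^r such that for every source configuration x : S → A^r: h_e(φ_i(x∣A_i), φ_j(x∣A_j)) = x(e) + x(⋆) if e is an edge of Cyc, and h_e(φ_i(x∣A_i), φ_j(x∣A_j)) = x(e) if e is not an edge of Cyc. (The terminal t_e can recover X_e + X_⋆ when e lies on the chosen shortest cycle, and X_e otherwise, from the two bottleneck values it receives.) -/
/-- Source index set for Construction 2: one source per vertex, one per edge,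
and the starred source. -/
abbrev Src2 {V : Type} (G : SimpleGraph V) : Type := V ⊕ ↥G.edgeSet ⊕ Unit

/-- The set `A_i` of sources connected to the tail of bottleneck edge `e_i` in
Construction 2: the vertex source `i`, the edge sources of edges incident to `i`,
and the starred source when `i` lies on the chosen shortest cycle `c`. -/
def A2 {V : Type} (G : SimpleGraph V) {v : V} (c : G.Walk v v) (i : V) :
    Set (Src2 G) :=
  fun s => match s with
  | Sum.inl j => j = i
  | Sum.inr (Sum.inl e) => i ∈ (e : Sym2 V)
  | Sum.inr (Sum.inr _) => i ∈ c.support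

/-- A Construction-2 `(r,l)`-code of capacity `α` over the finite field `A`:
encoding functions `φ i` on each bottleneck edge (depending only on the sources in `A_i`),
such that (i) each vertex-terminal `t_i`, (ii) each edge-terminal `t_e`, and
(iii) the starred terminal `t_⋆` can decode the sum of all sources. -/
def IsCode2 {V : Type} [Fintype V] [DecidableEq V] (G : SimpleGraph V)
    [DecidableRel G.Adj] {v : V} (c : G.Walk v v)
    (A : Type) [Field A] [Fintype A] (r l α : ℕ)
    (φ : ∀ i : V, (↥(A2 G c i) → (Fin r → A)) → (Fin (α * l) → A)) : Prop :=
  (∀ i : V,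
    ∃ ψ : (Fin (α * l) → A) → (↥((A2 G c i)ᶜ) → (Fin r → A)) → (Fin r → A),
      ∀ x : Src2 G → (Fin r → A),
        ψ (φ i (fun a => x a.1)) (fun a => x a.1) = ∑ s, x s) ∧
  (∀ i j : V, G.Adj i j →
    ∃ ψ : (Fin (α * l) → A) → (Fin (α * l) → A) →
        (↥((A2 G c i ∪ A2 G c j)ᶜ) → (Fin r → A)) → (Fin r → A),
      ∀ x : Src2 G → (Fin r → A),
        ψ (φ i (fun a => x a.1)) (φ j (fun a => x a.1)) (fun a => x a.1) = ∑ s, x s) ∧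
  (∃ ψ : (V → (Fin (α * l) → A)) → (Fin r → A),
      ∀ x : Src2 G → (Fin r → A),
        ψ (fun i => φ i (fun a => x a.1)) = ∑ s, x s)

/-- A decoder for the sum of all sources from the sources in `B` and some side information
depending only on `B` yields the sum over `B` when the remaining sources are set to zero. -/
theorem decode_zero_eq_sum_indicator {S M D : Type*} [Fintype S] [AddCommMonoid M] (B : Set S)
    (φ : (S → M) → D) (hφ : ∀ x y : S → M, (∀ s ∈ B, x s = y s) → φ x = φ y)
    (ψ : D → (↥Bᶜ → M) → M) (hψ : ∀ x : S → M, ψ (φ x) (fun a => x a.1) = ∑ s, x s)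
    (x : S → M) : ψ (φ x) (fun _ => 0) =
    ∑ s, B.indicator x s := by
  rw [← hψ]
  congr 1
  · exact hφ _ _ fun s hs => by simp [hs]
  · funext a
    exact (Set.indicator_of_notMem a.2 x).symm

/-- A shortest cycle has no chord. -/
theorem SimpleGraph.Walk.IsCycle.mem_edges_of_length_eq_girth {V : Type*} [DecidableEq V]
    {G : SimpleGraph V} {v : V} {c : G.Walk v v} (hc : c.IsCycle) (hshort : c.length = G.girth)
    {i j : V} (hij : G.Adj i j) (hi : i ∈ c.support) (hj : j ∈ c.support) :
    s(i, j) ∈ c.edges := by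
  by_contra hnot
  have hcr : (c.rotate i hi).IsCycle := hc.rotate hi
  have hlen : (c.rotate i hi).length = c.length := by simp
  have hedge : ∀ e, e ∈ (c.rotate i hi).edges → e ∈ c.edges := fun e he =>
    (c.rotate_edges i hi).mem_iff.mp he
  have hj' : j ∈ (c.rotate i hi).support := by simpa using hj
  generalize c.rotate i hi = d at *
  have hp : (d.takeUntil j hj').IsPath := hcr.isPath_takeUntil hj'
  have hcyc : (SimpleGraph.Walk.cons hij.symm (d.takeUntil j hj')).IsCycle := by
    rw [SimpleGraph.Walk.cons_isCycle_iff]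
    refine ⟨hp, fun h => hnot (hedge _ ?_)⟩
    rw [Sym2.eq_swap]
    exact d.edges_takeUntil_subset_edges hj' h
  have hle := hcyc.girth_le_length
  have hsum := congrArg SimpleGraph.Walk.length (d.take_spec hj')
  rw [SimpleGraph.Walk.length_append] at hsum
  rw [SimpleGraph.Walk.length_cons] at hle
  have hsub := d.edges_dropUntil_subset_edges hj'
  generalize d.dropUntil j hj' = q at *
  cases q with
  | nil => exact hij.ne rfl
  | cons h r =>
    rw [SimpleGraph.Walk.length_cons] at hsum
    have hr : r.length = 0 := by omega
    cases SimpleGraph.Walk.eq_of_length_eq_zero hr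
    refine hnot (hedge _ (hsub ?_))
    simp [Sym2.eq_swap]

/-- For a Construction-2 `(r,l)`-code of capacity `α`, for every edge `e = {i,j}` of the
graph the terminal `t_e` can recover `X_e + X_⋆` if `e` lies on the chosen shortest cycle
`c`, and `X_e` otherwise, from the values carried on the two bottleneck edges `e_i, e_j`. -/
theorem edge_terminal_recovery {V : Type} [Fintype V] [DecidableEq V] (G : SimpleGraph V)
    [DecidableRel G.Adj] (hG : G.Connected) {v : V} (c : G.Walk v v)
    (hc : c.IsCycle) (hshort : c.length = G.girth)
    (A : Type) [Field A] [Fintype A] (r l α : ℕ) (hr : 0 < r) (hl : 0 < l) (hα : 0 < α)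
    (φ : ∀ i : V, (↥(A2 G c i) → (Fin r → A)) → (Fin (α * l) → A))
    (hcode : IsCode2 G c A r l α φ) (i j : V) (hij : G.Adj i j) :
    ∃ h : (Fin (α * l) → A) → (Fin (α * l) → A) → (Fin r → A),
      ∀ x : Src2 G → (Fin r → A),
        h (φ i (fun a => x a.1)) (φ j (fun a => x a.1)) =
          if s(i, j) ∈ c.edges then
            x (Sum.inr (Sum.inl ⟨s(i, j), G.mem_edgeSet.mpr hij⟩)) + x (Sum.inr (Sum.inr ()))
          else
            x (Sum.inr (Sum.inl ⟨s(i, j), G.mem_edgeSet.mpr hij⟩)) := by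
  classical
  obtain ⟨hvert, hedge, -⟩ := hcode
  obtain ⟨ψi, hψi⟩ := hvert i
  obtain ⟨ψj, hψj⟩ := hvert j
  obtain ⟨ψe, hψe⟩ := hedge i j hij
  have restrict_congr : ∀ (k : V) (x y : Src2 G → Fin r → A),
      (∀ s ∈ A2 G c k, x s = y s) →
        φ k (fun a => x a.1) = φ k (fun a => y a.1) := fun k x y hxy =>
    congrArg (φ k) (funext fun a => hxy a.1 a.2)
  refine ⟨fun a b => ψi a (fun _ => 0) + ψj b (fun _ => 0) - ψe a b (fun _ => 0), fun x => ?_⟩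
  have hi := decode_zero_eq_sum_indicator (A2 G c i) (fun x => φ i (fun a => x a.1))
    (restrict_congr i) ψi hψi x
  have hj := decode_zero_eq_sum_indicator (A2 G c j) (fun x => φ j (fun a => x a.1))
    (restrict_congr j) ψj hψj x
  have he := decode_zero_eq_sum_indicator (A2 G c i ∪ A2 G c j)
    (fun x => (φ i (fun a => x a.1), φ j (fun a => x a.1)))
    (fun y z h => Prod.ext (restrict_congr i y z fun s hs => h s (Or.inl hs))
      (restrict_congr j y z fun s hs => h s (Or.inr hs)))
    (fun p => ψe p.1 p.2) hψe x
  simp only at hi hj he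
  simp only [hi, hj, he]
  have hinter : ∀ s, (A2 G c i).indicator x s + (A2 G c j).indicator x s -
      (A2 G c i ∪ A2 G c j).indicator x s = (A2 G c i ∩ A2 G c j).indicator x s := fun s => by
    rw [sub_eq_iff_eq_add', Set.indicator_union_add_inter_apply]
  rw [← Finset.sum_add_distrib, ← Finset.sum_sub_distrib, Finset.sum_congr rfl fun s _ => hinter s,
    Fintype.sum_sum_type, Fintype.sum_sum_type]
  have hV : ∀ k : V, ¬ ((Sum.inl k : Src2 G) ∈ A2 G c i ∧ (Sum.inl k : Src2 G) ∈ A2 G c j) :=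
    fun k h => hij.ne (Eq.trans (Eq.symm h.1) h.2)
  have hE : ∀ e : G.edgeSet, ((Sum.inr (Sum.inl e) : Src2 G) ∈ A2 G c i ∧
      (Sum.inr (Sum.inl e) : Src2 G) ∈ A2 G c j) ↔ e = ⟨s(i, j), G.mem_edgeSet.mpr hij⟩ :=
    fun e => by
      rw [Subtype.ext_iff]
      exact Sym2.mem_and_mem_iff hij.ne
  have hstar : ((Sum.inr (Sum.inr ()) : Src2 G) ∈ A2 G c i ∧
      (Sum.inr (Sum.inr ()) : Src2 G) ∈ A2 G c j) ↔ s(i, j) ∈ c.edges :=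
    ⟨fun h => hc.mem_edges_of_length_eq_girth hshort hij h.1 h.2, fun h =>
      ⟨c.fst_mem_support_of_mem_edges h, c.snd_mem_support_of_mem_edges h⟩⟩
  simp only [Set.indicator_apply, Set.mem_inter_iff, hV, hE, hstar, Finset.univ_unique, PUnit.default_eq_unit, Finset.sum_singleton,
    if_false, Finset.sum_const_zero, zero_add, Finset.sum_ite_eq', Finset.mem_univ, if_true]
  split_ifs <;> simp
end

section
/- Given a Construction-2 (r,l)-code of capacity α, the map sending a source configuration x : S → A^r to the tuple of bottleneck values (φ_i(x∣A_i))_{i∈Ṽ} is injective; equivalently, there exists H : (Ṽ → A^(αl)) → (S → A^r) with H((φ_i(x∣A_i))_{i∈Ṽ}) = x for all x. (The terminal t_⋆, which receives all bottleneck edges, can compute every individual source value.) -/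
/-- A shortest cycle has no chords. -/
theorem SimpleGraph.Walk.IsCycle.isChordless_of_length_eq_girth {V : Type*}
    {G : SimpleGraph V} {v : V} {c : G.Walk v v} (hc : c.IsCycle)
    (hshort : c.length = G.girth) : c.IsChordless := by
  classical
  rw [SimpleGraph.Walk.isChordless_iff_forall_mem_edges]
  intro u w hu hw hadj
  by_contra hne
  have hd : (c.rotate u hu).IsCycle := hc.rotate hu
  have hw' : w ∈ (c.rotate u hu).support := (c.mem_support_rotate_iff u hu).2 hw
  have hne' : s(u, w) ∉ (c.rotate u hu).edges := by
    rwa [(c.rotate_edges u hu).mem_iff]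
  have hlen : (c.rotate u hu).length = c.length := by
    simp
  generalize c.rotate u hu = d at hd hw' hne' hlen
  have hspec := d.take_spec hw'
  generalize d.takeUntil w hw' = p at hspec
  generalize d.dropUntil w hw' = q at hspec
  subst hspec
  simp only [SimpleGraph.Walk.edges_append, List.mem_append, not_or] at hne'
  have hp : p.IsPath := hd.isPath_of_append_left (SimpleGraph.Walk.not_nil_of_ne hadj.ne')
  have hq : q.IsPath := hd.isPath_of_append_right (SimpleGraph.Walk.not_nil_of_ne hadj.ne)
  have h₁ := SimpleGraph.girth_le_length
    ((SimpleGraph.Walk.cons_isCycle_iff p hadj.symm).2 ⟨hp, by simpa [Sym2.eq_swap] using hne'.1⟩)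
  have h₂ := SimpleGraph.girth_le_length
    ((SimpleGraph.Walk.cons_isCycle_iff q hadj).2 ⟨hq, hne'.2⟩)
  have h₃ := hc.three_le_length
  simp only [SimpleGraph.Walk.length_cons, SimpleGraph.Walk.length_append] at h₁ h₂ hlen
  omega

/-- A cycle has as many vertices as its length. -/
theorem SimpleGraph.Walk.IsCycle.card_toFinset_support {V : Type*} [DecidableEq V]
    {G : SimpleGraph V} {v : V} {c : G.Walk v v} (hc : c.IsCycle) :
    c.support.toFinset.card = c.length := by
  have hmem : v ∈ c.support.tail := SimpleGraph.Walk.end_mem_tail_support hc.not_nil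
  rw [← c.cons_tail_support, List.toFinset_cons, Finset.insert_eq_of_mem (by simpa using hmem),
    List.toFinset_card_of_nodup hc.support_nodup]
  simp

/-- As many edges of the graph join vertices of a chordless cycle as the cycle has vertices. -/
theorem SimpleGraph.Walk.IsCycle.card_filter_edges_within_support {V : Type*} [DecidableEq V]
    {G : SimpleGraph V} [Fintype G.edgeSet] {v : V} {c : G.Walk v v}
    [DecidablePred fun e : G.edgeSet => ∀ i ∈ (e : Sym2 V), i ∈ c.support] (hc : c.IsCycle)
    (hchord : c.IsChordless) :
    (Finset.univ.filter fun e : G.edgeSet => ∀ i ∈ (e : Sym2 V), i ∈ c.support).card =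
      c.length := by
  rw [← c.length_edges, ← List.toFinset_card_of_nodup hc.edges_nodup,
    ← Finset.card_map (Function.Embedding.subtype _)]
  congr 1
  ext e
  simp only [Finset.mem_map, Finset.mem_filter, Finset.mem_univ, true_and,
    Function.Embedding.subtype_apply, Subtype.exists, exists_and_right, exists_eq_right,
    List.mem_toFinset]
  constructor
  · rintro ⟨he, h⟩
    induction e with
    | _ u w => exact hchord.mem_edges (h u (by simp)) (h w (by simp)) he
  · intro h
    refine ⟨c.edges_subset_edgeSet h, fun i hi => ?_⟩
    exact c.mem_support_of_mem_edges h hi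

/-- If the restriction of a configuration to `T` enters a decoder of the total sum only through
`f`, then the sum over `T` is determined by `f`. -/
theorem sum_indicator_sub_eq_zero_of_decodes {S M B : Type*} [Fintype S] [AddCommGroup M]
    (T : Set S) (f : (T → M) → B) (ψ : B → (↥(Tᶜ) → M) → M)
    (hψ : ∀ x : S → M, ψ (f fun a => x a.1) (fun a => x a.1) = ∑ s, x s)
    {x y : S → M} (hxy : (f fun a => x a.1) = f fun a => y a.1) :
    ∑ s, T.indicator (x - y) s = 0 := by
  classical
  set z : S → M := fun s => if s ∈ T then y s else x s with hz
  have hT : (fun a : T => z a.1) = fun a => y a.1 := by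
    funext a
    simp [hz, a.2]
  have hTc : (fun a : ↥(Tᶜ) => z a.1) = fun a => x a.1 := by
    funext a
    exact if_neg a.2
  have hsum : ∑ s, x s = ∑ s, z s := by
    rw [← hψ x, ← hψ z, hT, hTc, hxy]
  rw [← sub_eq_zero, ← Finset.sum_sub_distrib] at hsum
  rw [← hsum]
  refine Finset.sum_congr rfl fun s _ => ?_
  by_cases hs : s ∈ T <;> simp [hz, hs]

@[simp]
theorem inl_mem_A2 {V : Type} {G : SimpleGraph V} {v : V} {c : G.Walk v v} {i j : V} :
    (Sum.inl j : Src2 G) ∈ A2 G c i ↔ j = i := Iff.rfl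

@[simp]
theorem inr_inl_mem_A2 {V : Type} {G : SimpleGraph V} {v : V} {c : G.Walk v v} {i : V}
    {e : G.edgeSet} : (Sum.inr (Sum.inl e) : Src2 G) ∈ A2 G c i ↔ i ∈ (e : Sym2 V) := Iff.rfl

@[simp]
theorem inr_inr_mem_A2 {V : Type} {G : SimpleGraph V} {v : V} {c : G.Walk v v} {i : V}
    {u : Unit} : (Sum.inr (Sum.inr u) : Src2 G) ∈ A2 G c i ↔ i ∈ c.support := Iff.rfl

/-- A configuration on the sources of Construction 2 vanishes if its sums over all the sets `A_i`,
over all the sets `A_i ∪ A_j` with `i`, `j` adjacent, and over all sources vanish. -/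
theorem eq_zero_of_sum_indicator_eq_zero {V M : Type} [Fintype V] [DecidableEq V]
    (G : SimpleGraph V) [DecidableRel G.Adj] {v : V} (c : G.Walk v v)
    (hc : c.IsCycle) (hchord : c.IsChordless) [AddCommGroup M] (d : Src2 G → M)
    (hvert : ∀ i, ∑ s, (A2 G c i).indicator d s = 0)
    (hedge : ∀ i j, G.Adj i j → ∑ s, (A2 G c i ∪ A2 G c j).indicator d s = 0)
    (hall : ∑ s, d s = 0) : d = 0 := by
  classical
  set t := d (Sum.inr (Sum.inr ())) with ht
  have hvert' : ∀ i, d (Sum.inl i) +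
      (∑ e : G.edgeSet, (if i ∈ (e : Sym2 V) then d (Sum.inr (Sum.inl e)) else 0) +
        if i ∈ c.support then t else 0) = 0 := by
    intro i
    refine Eq.trans ?_ (hvert i)
    simp [Fintype.sum_sum_type, Set.indicator_apply, ht]
  have hinter : ∀ i j, G.Adj i j → ∑ s, (A2 G c i ∩ A2 G c j).indicator d s = 0 := by
    intro i j hij
    have h := Set.indicator_union_add_inter d (A2 G c i) (A2 G c j)
    have h' := congrArg (fun g : Src2 G → M => ∑ s, g s) h
    simpa [Finset.sum_add_distrib, hvert, hedge i j hij] using h'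
  have hedge' : ∀ e : G.edgeSet, d (Sum.inr (Sum.inl e)) +
      (if ∀ i ∈ (e : Sym2 V), i ∈ c.support then t else 0) = 0 := by
    rintro ⟨e, he⟩
    induction e with
    | _ i j =>
      have hij : G.Adj i j := he
      have hmem : ∀ e : G.edgeSet, (i ∈ (e : Sym2 V) ∧ j ∈ (e : Sym2 V)) ↔ e = ⟨s(i, j), he⟩ := by
        intro e
        rw [Sym2.mem_and_mem_iff hij.ne, Subtype.ext_iff]
      have h1 := hinter i j hij
      rw [Fintype.sum_sum_type, Fintype.sum_sum_type] at h1
      have e1 : ∀ k, (A2 G c i ∩ A2 G c j).indicator d (Sum.inl k) = 0 := fun k =>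
        Set.indicator_of_notMem (fun hk => hij.ne (hk.1.symm.trans hk.2)) _
      have e2 : ∀ e : G.edgeSet, (A2 G c i ∩ A2 G c j).indicator d (Sum.inr (Sum.inl e)) =
          if e = ⟨s(i, j), he⟩ then d (Sum.inr (Sum.inl e)) else 0 := fun e => by
        rw [Set.indicator_apply]
        exact if_congr (hmem e) rfl rfl
      have e3 : (A2 G c i ∩ A2 G c j).indicator d (Sum.inr (Sum.inr ())) =
          if i ∈ c.support ∧ j ∈ c.support then t else 0 := by
        rw [Set.indicator_apply]
        exact if_congr Iff.rfl rfl rfl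
      simpa [e1, e2, e3] using h1
  have hvsum : ∑ i, d (Sum.inl i) + ((2 • ∑ e : G.edgeSet, d (Sum.inr (Sum.inl e))) +
      c.length • t) = 0 := by
    have h := Finset.sum_eq_zero fun i (_ : i ∈ Finset.univ) => hvert' i
    rw [Finset.sum_add_distrib, Finset.sum_add_distrib, Finset.sum_comm] at h
    have hdeg : ∀ e : G.edgeSet,
        ∑ i, (if i ∈ (e : Sym2 V) then d (Sum.inr (Sum.inl e)) else 0) =
          2 • d (Sum.inr (Sum.inl e)) := by
      intro e
      rw [← Finset.sum_filter, Finset.sum_const]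
      congr 1
      rw [← Sym2.card_toFinset_of_not_isDiag _ (G.not_isDiag_of_mem_edgeSet e.2)]
      congr 1
      ext i
      simp
    have hcyc : ∑ i, (if i ∈ c.support then t else 0) = c.length • t := by
      rw [← Finset.sum_filter, Finset.sum_const, ← hc.card_toFinset_support]
      congr 2
      ext i
      simp
    rwa [Finset.sum_congr rfl fun e _ => hdeg e, hcyc, ← Finset.smul_sum] at h
  have hesum : ∑ e : G.edgeSet, d (Sum.inr (Sum.inl e)) + c.length • t = 0 := by
    have h := Finset.sum_eq_zero fun e (_ : e ∈ Finset.univ) => hedge' e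
    rwa [Finset.sum_add_distrib, ← Finset.sum_filter, Finset.sum_const,
      hc.card_filter_edges_within_support hchord] at h
  have htot : ∑ i, d (Sum.inl i) + (∑ e : G.edgeSet, d (Sum.inr (Sum.inl e)) + t) = 0 := by
    rw [← hall]
    simp [Fintype.sum_sum_type, ht]
  have ht0 : t = 0 := by
    have h := congrArg₂ (· - ·) (congrArg₂ (· + ·) htot hesum) hvsum
    simp only [add_zero, sub_zero] at h
    rw [← h]
    abel
  have he0 : ∀ e : G.edgeSet, d (Sum.inr (Sum.inl e)) = 0 := fun e => by
    simpa [ht0] using hedge' e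
  have hv0 : ∀ i, d (Sum.inl i) = 0 := fun i => by
    simpa [ht0, he0] using hvert' i
  funext s
  rcases s with i | e | ⟨⟩
  · exact hv0 i
  · exact he0 e
  · exact ht0

/-- For a Construction-2 `(r,l)`-code of capacity `α`, the starred terminal `t_⋆`,
which observes all bottleneck edges, can compute every individual source value:
the map `x ↦ (φ i (x∣A_i))_{i ∈ Ṽ}` is invertible on its image. -/
theorem star_terminal_recovers_all_sources {V : Type} [Fintype V] [DecidableEq V]
    (G : SimpleGraph V) [DecidableRel G.Adj] (hG : G.Connected) {v : V} (c : G.Walk v v)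
    (hc : c.IsCycle) (hshort : c.length = G.girth)
    (A : Type) [Field A] [Fintype A] (r l α : ℕ) (hr : 0 < r) (hl : 0 < l) (hα : 0 < α)
    (φ : ∀ i : V, (↥(A2 G c i) → (Fin r → A)) → (Fin (α * l) → A))
    (hcode : IsCode2 G c A r l α φ) :
    ∃ H : (V → (Fin (α * l) → A)) → (Src2 G → (Fin r → A)),
      ∀ x : Src2 G → (Fin r → A), H (fun i => φ i (fun a => x a.1)) = x := by
  classical
  obtain ⟨hvert, hedge, ψ, hψ⟩ := hcode
  have hinj : Function.Injective
      (fun (x : Src2 G → (Fin r → A)) i => φ i (fun a => x a.1)) := by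
    intro x y hxy
    have hφ : ∀ i, φ i (fun a => x a.1) = φ i (fun a => y a.1) := congrFun hxy
    refine sub_eq_zero.1 (eq_zero_of_sum_indicator_eq_zero G c hc
      (hc.isChordless_of_length_eq_girth hshort) (x - y) ?_ ?_ ?_)
    · intro i
      obtain ⟨ψ, hψ⟩ := hvert i
      exact sum_indicator_sub_eq_zero_of_decodes _ (φ i) ψ hψ (hφ i)
    · intro i j hij
      obtain ⟨ψ, hψ⟩ := hedge i j hij
      refine sum_indicator_sub_eq_zero_of_decodes (A2 G c i ∪ A2 G c j)
        (fun z => (φ i fun a => z ⟨a.1, Or.inl a.2⟩, φ j fun a => z ⟨a.1, Or.inr a.2⟩))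
        (fun b => ψ b.1 b.2) hψ ?_
      exact Prod.ext (hφ i) (hφ j)
    · have h : ∑ s, x s = ∑ s, y s := by
        rw [← hψ x, ← hψ y, funext hφ]
      simp [h]
  exact ⟨Function.invFun _, Function.leftInverse_invFun hinj⟩
end

section
/- (Remark 1) If a Construction-1 (r,l)-code of capacity α exists, then r·(|Ẽ| + |Ṽ|) ≤ l·α·|Ṽ|; equivalently, the rate r/l of any fractional network coding solution for the Construction-1 sum-network (without the starred source) is at most α|Ṽ|/(|Ẽ| + |Ṽ|). -/
/-- Source index set for Construction 1: one source per vertex and one per edge. -/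
abbrev Src1 {V : Type} (G : SimpleGraph V) : Type := V ⊕ ↥G.edgeSet

/-- The set `A_i` of sources connected to the tail of bottleneck edge `e_i` in
Construction 1: the vertex source `i` and the edge sources of edges incident to `i`. -/
def A1 {V : Type} (G : SimpleGraph V) (i : V) : Set (Src1 G) :=
  fun s => match s with
  | Sum.inl j => j = i
  | Sum.inr e => i ∈ (e : Sym2 V)

/-- A Construction-1 `(r,l)`-code of capacity `α` over the finite field `A`:
encoding functions `φ i` on each bottleneck edge (depending only on the sources in `A_i`),
such that (i) each vertex-terminal `t_i`, (ii) each edge-terminal `t_e`, and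
(iii) the starred terminal `t_⋆` can decode the sum of all sources. -/
def IsCode1 {V : Type} [Fintype V] [DecidableEq V] (G : SimpleGraph V)
    [DecidableRel G.Adj] (A : Type) [Field A] [Fintype A] (r l α : ℕ)
    (φ : ∀ i : V, (↥(A1 G i) → (Fin r → A)) → (Fin (α * l) → A)) : Prop :=
  (∀ i : V,
    ∃ ψ : (Fin (α * l) → A) → (↥((A1 G i)ᶜ) → (Fin r → A)) → (Fin r → A),
      ∀ x : Src1 G → (Fin r → A),
        ψ (φ i (fun a => x a.1)) (fun a => x a.1) = ∑ s, x s) ∧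
  (∀ i j : V, G.Adj i j →
    ∃ ψ : (Fin (α * l) → A) → (Fin (α * l) → A) →
        (↥((A1 G i ∪ A1 G j)ᶜ) → (Fin r → A)) → (Fin r → A),
      ∀ x : Src1 G → (Fin r → A),
        ψ (φ i (fun a => x a.1)) (φ j (fun a => x a.1)) (fun a => x a.1) = ∑ s, x s) ∧
  (∃ ψ : (V → (Fin (α * l) → A)) → (Fin r → A),
      ∀ x : Src1 G → (Fin r → A),
        ψ (fun i => φ i (fun a => x a.1)) = ∑ s, x s)

/-- A feasible CODE-FEAS-1 assignment: nonnegative integers `m e i` for each edge `e` and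
endpoint `i` of `e` with `m e i + m e j = |Ṽ|` for every edge `e = {i,j}` and
`∑_{e ∋ i} m e i ≤ |Ẽ|` for every vertex `i`. -/
def Feas1 {V : Type} [Fintype V] [DecidableEq V] (G : SimpleGraph V)
    [DecidableRel G.Adj] (m : Sym2 V → V → ℕ) : Prop :=
  (∀ i j : V, G.Adj i j → m s(i, j) i + m s(i, j) j = Fintype.card V) ∧
  (∀ i : V, ∑ e ∈ G.edgeFinset.filter (fun e => i ∈ e), m e i ≤ G.edgeFinset.card)

/-- The only source shared by two adjacent vertices is the edge joining them. -/
theorem A1_inter_of_adj {V : Type} {G : SimpleGraph V} {i j : V} (h : G.Adj i j) :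
    A1 G i ∩ A1 G j = {Sum.inr ⟨s(i, j), h⟩} := by
  ext s
  rcases s with k | e
  · simp only [Set.mem_inter_iff, Set.mem_singleton_iff, reduceCtorEq, iff_false]
    rintro ⟨hi, hj⟩
    exact h.ne (Eq.trans (Eq.symm hi) hj)
  · simp only [Set.mem_inter_iff, Set.mem_singleton_iff, Sum.inr.injEq, Subtype.ext_iff]
    exact Sym2.mem_and_mem_iff h.ne

/-- Restricting to `s` a configuration that has been zeroed outside `t ⊇ s` changes nothing. -/
theorem restrict_indicator_of_subset {ι M : Type*} [Zero M] {s t : Set ι} (h : s ⊆ t)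
    (x : ι → M) : (fun a : s => t.indicator x a) = fun a : s => x a :=
  funext fun a => Set.indicator_of_mem (h a.2) x

/-- Zeroing a configuration outside `t` makes its restriction to the complement vanish. -/
theorem restrict_compl_indicator {ι M : Type*} [Zero M] (t : Set ι) (x : ι → M) :
    (fun a : ↥tᶜ => t.indicator x a) = fun _ => 0 :=
  funext fun a => Set.indicator_of_notMem a.2 x

section

variable {V : Type} [Fintype V] [DecidableEq V] {G : SimpleGraph V} [DecidableRel G.Adj]
  {A : Type} [Field A] [Fintype A] {r l α : ℕ}
  {φ : ∀ i : V, (↥(A1 G i) → (Fin r → A)) → (Fin (α * l) → A)}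

/-- The encoding at `i` determines the sum of the sources in `A_i`. -/
theorem IsCode1.sum_indicator_eq (hcode : IsCode1 G A r l α φ) {x y : Src1 G → (Fin r → A)}
    {i : V} (h : φ i (fun a => x a.1) = φ i (fun a => y a.1)) :
    ∑ s, (A1 G i).indicator x s = ∑ s, (A1 G i).indicator y s := by
  obtain ⟨ψ, hψ⟩ := hcode.1 i
  simp only [← hψ, restrict_indicator_of_subset subset_rfl, restrict_compl_indicator, h]

/-- The encodings at adjacent `i` and `j` determine the sum of the sources in `A_i ∪ A_j`. -/
theorem IsCode1.sum_indicator_union_eq (hcode : IsCode1 G A r l α φ)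
    {x y : Src1 G → (Fin r → A)} {i j : V} (hij : G.Adj i j)
    (hi : φ i (fun a => x a.1) = φ i (fun a => y a.1))
    (hj : φ j (fun a => x a.1) = φ j (fun a => y a.1)) :
    ∑ s, (A1 G i ∪ A1 G j).indicator x s = ∑ s, (A1 G i ∪ A1 G j).indicator y s := by
  obtain ⟨ψ, hψ⟩ := hcode.2.1 i j hij
  simp only [← hψ, restrict_indicator_of_subset Set.subset_union_left,
    restrict_indicator_of_subset Set.subset_union_right, restrict_compl_indicator, hi, hj]

/-- The encodings jointly determine the whole source configuration. -/
theorem IsCode1.injective (hcode : IsCode1 G A r l α φ) :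
    Function.Injective fun (x : Src1 G → (Fin r → A)) (i : V) => φ i (fun a => x a.1) := by
  intro x y hxy
  have hφ (i : V) : φ i (fun a => x a.1) = φ i (fun a => y a.1) := congrFun hxy i
  have hedge (e : G.edgeSet) : x (Sum.inr e) = y (Sum.inr e) := by
    obtain ⟨e, he⟩ := e
    induction e with
    | _ i j =>
      have key (z : Src1 G → (Fin r → A)) :
          ∑ s, (A1 G i ∪ A1 G j).indicator z s + z (Sum.inr ⟨s(i, j), he⟩) =
            ∑ s, (A1 G i).indicator z s + ∑ s, (A1 G j).indicator z s := by
        have hz : ∑ s, (A1 G i ∩ A1 G j).indicator z s = z (Sum.inr ⟨s(i, j), he⟩) := by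
          classical
          rw [A1_inter_of_adj he]
          simp [Set.indicator_apply]
        rw [← hz, ← Finset.sum_add_distrib, ← Finset.sum_add_distrib]
        exact Finset.sum_congr rfl fun s _ =>
          congrFun (Set.indicator_union_add_inter z (A1 G i) (A1 G j)) s
      have hx := key x
      rw [hcode.sum_indicator_eq (hφ i), hcode.sum_indicator_eq (hφ j),
        hcode.sum_indicator_union_eq he (hφ i) (hφ j), ← key y] at hx
      exact add_left_cancel hx
  funext s
  rcases s with i | e
  · have key (z : Src1 G → (Fin r → A)) : ∑ s, (A1 G i).indicator z s =
        z (Sum.inl i) + ∑ e, (A1 G i).indicator z (Sum.inr e) := by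
      rw [Fintype.sum_sum_type, Finset.sum_eq_single i]
      · rw [Set.indicator_of_mem (show Sum.inl i ∈ A1 G i from rfl)]
      · exact fun j _ hj => Set.indicator_of_notMem (s := A1 G i) (a := Sum.inl j) hj z
      · simp
    have hx := hcode.sum_indicator_eq (hφ i)
    rw [key x, key y] at hx
    have hsum : ∑ e, (A1 G i).indicator x (Sum.inr e) = ∑ e, (A1 G i).indicator y (Sum.inr e) := by
      classical
      simp only [Set.indicator_apply, hedge]
    rw [hsum] at hx
    exact add_right_cancel hx
  · exact hedge e

end

/-- **Remark 1.** If a Construction-1 `(r,l)`-code of capacity `α` exists for the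
sum-network built from the graph `G` (without the starred source), then
`r·(|Ẽ| + |Ṽ|) ≤ l·α·|Ṽ|`; i.e. the rate `r/l` is at most `α|Ṽ|/(|Ẽ| + |Ṽ|)`. -/
theorem construction1_rate_upper_bound {V : Type} [Fintype V] [DecidableEq V]
    (G : SimpleGraph V) [DecidableRel G.Adj] (hG : G.Connected)
    (A : Type) [Field A] [Fintype A] (r l α : ℕ) (hr : 0 < r) (hl : 0 < l) (hα : 0 < α)
    (φ : ∀ i : V, (↥(A1 G i) → (Fin r → A)) → (Fin (α * l) → A))
    (hcode : IsCode1 G A r l α φ) :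
    r * (G.edgeFinset.card + Fintype.card V) ≤ l * (α * Fintype.card V) := by
  have hcard := Fintype.card_le_of_injective _ hcode.injective
  simp only [Fintype.card_fun, Fintype.card_fin, Fintype.card_sum, ← pow_mul] at hcard
  have hle := (Nat.pow_le_pow_iff_right Fintype.one_lt_card).mp hcard
  rw [← SimpleGraph.edgeFinset_card] at hle
  linarith
end

section
/- (Claim 2, regular case) Let G̃ = (Ṽ, Ẽ) be a finite connected k-regular simple graph on b = |Ṽ| vertices with k ≥ 1. Then G̃ admits a feasible CODE-FEAS-1 assignment; moreover the assignment can be chosen so that Σ_{e incident to i} m_e(i) = |Ẽ| for every vertex i. -/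
/-- In a finite `2 * d`-regular graph, one can choose an endpoint of every edge so that each vertex
is chosen exactly `d` times. -/
theorem SimpleGraph.IsRegularOfDegree.exists_balanced_head {V : Type*} [Fintype V] [DecidableEq V]
    {G : SimpleGraph V} [DecidableRel G.Adj] {d : ℕ} (hreg : G.IsRegularOfDegree (2 * d)) :
    ∃ head : Sym2 V → V, (∀ e ∈ G.edgeFinset, head e ∈ e) ∧
      ∀ v, (G.edgeFinset.filter (fun e => head e = v)).card = d := by
  let t : G.edgeFinset → Finset (V × Fin d) := fun e =>
    (Finset.univ.filter (fun v => v ∈ e.1)) ×ˢ Finset.univ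
  have hall : ∀ S : Finset G.edgeFinset, S.card ≤ (S.biUnion t).card := by
    intro S
    let ends : Finset V := Finset.univ.filter (fun v => ∃ e ∈ S, v ∈ e.1)
    have hends : S.biUnion t = ends ×ˢ Finset.univ := by
      ext ⟨v, i⟩
      simp [t, ends]
    have two_mul_card_le : S.card * 2 ≤ ends.card * (2 * d) := by
      refine Finset.card_mul_le_card_mul (fun (e : G.edgeFinset) v => v ∈ e.1) ?_ ?_
      · rintro ⟨e, he⟩ heS
        have hcard : e.toFinset.card = 2 := Sym2.card_toFinset_of_not_isDiag e
          (G.not_isDiag_of_mem_edgeFinset he)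
        rw [← hcard]
        refine Finset.card_le_card fun v hv => ?_
        rw [Sym2.mem_toFinset] at hv
        simp only [Finset.mem_bipartiteAbove, ends, Finset.mem_filter, Finset.mem_univ, true_and]
        exact ⟨⟨_, heS, hv⟩, hv⟩
      · intro v _
        rw [← hreg.degree_eq v, ← G.card_incidenceFinset_eq_degree, G.incidenceFinset_eq_filter]
        refine Finset.card_le_card_of_injOn Subtype.val ?_ Subtype.val_injective.injOn
        intro e he
        have hve := (Finset.mem_bipartiteBelow _).1 he
        exact Finset.mem_filter.2 ⟨e.2, hve.2⟩
    rw [hends, Finset.card_product, Finset.card_univ, Fintype.card_fin]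
    linarith
  obtain ⟨f, hf, hft⟩ := (Finset.all_card_le_biUnion_card_iff_exists_injective t).1 hall
  have hcard : Fintype.card G.edgeFinset = Fintype.card (V × Fin d) := by
    have h := G.sum_degrees_eq_twice_card_edges
    simp only [hreg.degree_eq, Finset.sum_const, Finset.card_univ, smul_eq_mul] at h
    rw [Fintype.card_coe, Fintype.card_prod, Fintype.card_fin]
    linarith
  have hbij : Function.Bijective f := (Fintype.bijective_iff_injective_and_card f).2 ⟨hf, hcard⟩
  refine ⟨fun e => if he : e ∈ G.edgeFinset then (f ⟨e, he⟩).1 else e.out.1, ?_, ?_⟩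
  · intro e he
    have h := hft ⟨e, he⟩
    simp only [t, Finset.mem_product, Finset.mem_filter, Finset.mem_univ, true_and, and_true] at h
    simpa only [dif_pos he] using h
  · intro v
    beta_reduce
    refine Eq.symm ((Finset.card_fin d).symm.trans ?_)
    let g := (Equiv.ofBijective f hbij).symm
    have hfg : ∀ p, f (g p) = p := (Equiv.ofBijective f hbij).apply_symm_apply
    refine Finset.card_bij (fun i _ => (g (v, i)).1) ?_ ?_ ?_
    · intro i _
      refine Finset.mem_filter.2 ⟨(g (v, i)).2, ?_⟩
      rw [dif_pos (g (v, i)).2, Subtype.coe_eta, hfg]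
    · intro i _ j _ hij
      have h := g.injective (Subtype.ext hij)
      exact (Prod.ext_iff.1 h).2
    · intro e he
      obtain ⟨he, hv⟩ := Finset.mem_filter.1 he
      rw [dif_pos he] at hv
      refine ⟨(f ⟨e, he⟩).2, Finset.mem_univ _, ?_⟩
      rw [← hv]
      exact congrArg Subtype.val ((Equiv.ofBijective f hbij).symm_apply_apply ⟨e, he⟩)


/-- **Claim 2 (regular case).** Every finite connected `k`-regular simple graph (`k ≥ 1`)
on `b = |Ṽ|` vertices admits a feasible CODE-FEAS-1 assignment: nonnegative integers
`m e i` for each edge `e` and endpoint `i` with `m e i + m e j = |Ṽ|` for every edge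
`e = {i,j}` and `∑_{e ∋ i} m e i ≤ |Ẽ|` for every vertex `i`; moreover the assignment can
be chosen so that `∑_{e ∋ i} m e i = |Ẽ|` for every vertex `i`. -/
theorem regular_graph_feasible_assignment {V : Type} [Fintype V] [DecidableEq V]
    (G : SimpleGraph V) [DecidableRel G.Adj] (hG : G.Connected) (k : ℕ) (hk : 1 ≤ k)
    (hreg : G.IsRegularOfDegree k) :
    ∃ m : Sym2 V → V → ℕ,
      (∀ i j : V, G.Adj i j → m s(i, j) i + m s(i, j) j = Fintype.card V) ∧
      (∀ i : V, ∑ e ∈ G.edgeFinset.filter (fun e => i ∈ e), m e i ≤ G.edgeFinset.card) ∧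
      (∀ i : V, ∑ e ∈ G.edgeFinset.filter (fun e => i ∈ e), m e i = G.edgeFinset.card) := by
  have hedges : Fintype.card V * k = 2 * G.edgeFinset.card := by
    simpa [hreg.degree_eq] using G.sum_degrees_eq_twice_card_edges
  have hdeg : ∀ i, (G.edgeFinset.filter (fun e => i ∈ e)).card = k := fun i => by
    rw [← G.incidenceFinset_eq_filter, G.card_incidenceFinset_eq_degree, hreg.degree_eq]
  suffices h : ∃ m : Sym2 V → V → ℕ,
      (∀ i j : V, G.Adj i j → m s(i, j) i + m s(i, j) j = Fintype.card V) ∧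
      ∀ i : V, ∑ e ∈ G.edgeFinset.filter (fun e => i ∈ e), m e i = G.edgeFinset.card by
    obtain ⟨m, hm, hsum⟩ := h
    exact ⟨m, hm, fun i => (hsum i).le, hsum⟩
  obtain ⟨c, hc | hc⟩ := Nat.even_or_odd' (Fintype.card V)
  · refine ⟨fun _ _ => c, fun _ _ _ => by lia, fun i => ?_⟩
    rw [Finset.sum_const, hdeg, smul_eq_mul]
    rw [hc] at hedges
    linarith
  · obtain ⟨d, rfl⟩ : 2 ∣ k :=
      (Nat.coprime_two_left.2 ⟨c, hc⟩).dvd_of_dvd_mul_left ⟨_, hedges⟩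
    obtain ⟨head, hmem, hhead⟩ := hreg.exists_balanced_head
    refine ⟨fun e v => c + if head e = v then 1 else 0, fun i j hij => ?_, fun i => ?_⟩
    · have h := hmem s(i, j) (G.mem_edgeFinset.2 hij)
      have hne := hij.ne
      rcases Sym2.mem_iff.1 h with h | h
      · simp only [h, if_true, if_neg hne]
        lia
      · simp only [h, if_true, if_neg hne.symm]
        lia
    · have hfilter : (G.edgeFinset.filter (fun e => i ∈ e)).filter (fun e => head e = i) =
          G.edgeFinset.filter (fun e => head e = i) := by
        rw [Finset.filter_filter]
        refine Finset.filter_congr fun e he => and_iff_right_of_imp ?_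
        rintro rfl
        exact hmem e he
      rw [Finset.sum_add_distrib, Finset.sum_const, hdeg, Finset.sum_boole, hfilter, hhead,
        smul_eq_mul, Nat.cast_id]
      rw [hc] at hedges
      linarith
end

section
/- (Theorem 2) Let G̃ = (Ṽ, Ẽ) be a finite connected simple graph that admits a feasible CODE-FEAS-1 assignment, and let A be any finite field. Then with r = |Ṽ| and l = |Ṽ| + |Ẽ| there exists a Construction-1 (r,l)-code of capacity α = 1 in which every encoding map φ_i is A-linear; in particular, the sum of all sources can be computed at all terminals at rate |Ṽ|/(|Ṽ|+|Ẽ|). -/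
/-- Two endpoints of an edge can split the `n` coordinates of the edge source between them
in any prescribed proportion. -/
lemma exists_coordinate_split {V : Type} [DecidableEq V] (G : SimpleGraph V) (n : ℕ)
    (m : Sym2 V → V → ℕ) (hm : ∀ i j : V, G.Adj i j → m s(i, j) i + m s(i, j) j = n)
    (e : Sym2 V) :
    ∃ C : V → Finset (Fin n), e ∈ G.edgeSet →
      (∀ i ∈ e, (C i).card = m e i) ∧ ∀ i j, e = s(i, j) → ∀ k, k ∈ C i ∨ k ∈ C j := by
  induction e using Sym2.ind with
  | _ a b =>
    by_cases hab : G.Adj a b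
    · have hsum := hm a b hab
      obtain ⟨S, -, hS⟩ := Finset.exists_subset_card_eq
        (s := (Finset.univ : Finset (Fin n))) (n := m s(a, b) a) (by simp; omega)
      have hne : b ≠ a := hab.ne'
      refine ⟨fun i => if i = a then S else Sᶜ, fun _ => ⟨?_, ?_⟩⟩
      · intro i hi
        rcases Sym2.mem_iff.mp hi with rfl | rfl
        · simpa using hS
        · simp only [hne, if_false, Finset.card_compl, Fintype.card_fin, hS]
          omega
      · intro i j hij k
        rcases Sym2.eq_iff.mp hij with ⟨rfl, rfl⟩ | ⟨rfl, rfl⟩ <;> simp [hne] <;> tauto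
    · exact ⟨fun _ => ∅, fun h => absurd h hab⟩

/-- Linear encoders over an index type of size at most `N` can be rewritten with values in
`Fin N → A` without changing which inputs are annihilated. -/
lemma exists_linear_fin_of_card_le {A M T : Type} [Field A] [AddCommGroup M] [Module A M]
    [Fintype T] {N : ℕ} (hT : Fintype.card T ≤ N) (L : M →ₗ[A] (T → A)) :
    ∃ φ : M →ₗ[A] (Fin N → A), ∀ x, φ x = 0 → L x = 0 := by
  obtain ⟨f⟩ : Nonempty (T ↪ Fin N) :=
    Function.Embedding.nonempty_of_card_le (by simpa using hT)
  refine ⟨Function.ExtendByZero.linearMap A f ∘ₗ L, fun x hx => funext fun t => ?_⟩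
  have := congrFun hx (f t)
  simpa [f.injective.extend_apply] using this

open Classical in
/-- Under a feasible assignment there are linear encoders within capacity whose kernels
consist of inputs with vanishing local sum, such that adjacent encoders jointly determine
the source on their common edge. -/
lemma exists_linear_encoders {V : Type} [Fintype V] [DecidableEq V]
    (G : SimpleGraph V) [DecidableRel G.Adj] (m : Sym2 V → V → ℕ) (hm : Feas1 G m)
    (A : Type) [Field A] :
    ∃ φ : ∀ i : V, (↥(A1 G i) → (Fin (Fintype.card V) → A)) →ₗ[A]
        (Fin (1 * (Fintype.card V + G.edgeFinset.card)) → A),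
      (∀ (i : V) (d : Src1 G → Fin (Fintype.card V) → A), φ i (fun a => d a.1) = 0 →
        (∑ s, if s ∈ A1 G i then d s else 0) = 0) ∧
      (∀ (i j : V) (d : Src1 G → Fin (Fintype.card V) → A), φ i (fun a => d a.1) = 0 →
        φ j (fun a => d a.1) = 0 → ∀ e : G.edgeSet, (e : Sym2 V) = s(i, j) →
          d (Sum.inr e) = 0) := by
  choose C hC using exists_coordinate_split G _ m hm.1
  let K : V → Type := fun i =>
    Σ e : {e // e ∈ G.edgeFinset.filter (fun e => i ∈ e)}, {k // k ∈ C e.1 i}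
  have hK (i : V) : Fintype.card (Fin (Fintype.card V) ⊕ K i) ≤
      1 * (Fintype.card V + G.edgeFinset.card) := by
    have : Fintype.card (K i) ≤ G.edgeFinset.card := by
      refine le_trans (le_of_eq ?_) (hm.2 i)
      simp only [K, Fintype.card_sigma, Fintype.card_coe]
      rw [Finset.sum_coe_sort (G.edgeFinset.filter (fun e => i ∈ e)) fun e => (C e i).card]
      refine Finset.sum_congr rfl fun e he => ?_
      rw [Finset.mem_filter, SimpleGraph.mem_edgeFinset] at he
      exact (hC e he.1).1 i he.2
    rw [Fintype.card_sum, Fintype.card_fin]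
    omega
  have mem_edge {i : V} (e : {e // e ∈ G.edgeFinset.filter (fun e => i ∈ e)}) :
      (e : Sym2 V) ∈ G.edgeSet :=
    SimpleGraph.mem_edgeFinset.mp (Finset.mem_filter.mp e.2).1
  have mem_vertex {i : V} (e : {e // e ∈ G.edgeFinset.filter (fun e => i ∈ e)}) :
      (Sum.inr ⟨e, mem_edge e⟩ : Src1 G) ∈ A1 G i :=
    (Finset.mem_filter.mp e.2).2
  let L (i : V) : (↥(A1 G i) → (Fin (Fintype.card V) → A)) →ₗ[A]
      (Fin (Fintype.card V) ⊕ K i → A) :=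
    LinearMap.pi (Sum.elim (fun k => LinearMap.proj k ∘ₗ ∑ a, LinearMap.proj a)
      (fun p => LinearMap.proj p.2.1 ∘ₗ LinearMap.proj ⟨_, mem_vertex p.1⟩))
  choose φ hφ using fun i => exists_linear_fin_of_card_le (hK i) (L i)
  have edge_coord (i : V) (d : Src1 G → Fin (Fintype.card V) → A)
      (h : φ i (fun a => d a.1) = 0) (e : G.edgeSet) (hi : i ∈ (e : Sym2 V))
      (k : Fin (Fintype.card V)) (hk : k ∈ C e i) : d (Sum.inr e) k = 0 := by
    have he : (e : Sym2 V) ∈ G.edgeFinset.filter (fun e => i ∈ e) := by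
      simp [hi]
    simpa [L] using congrFun (hφ i _ h) (Sum.inr ⟨⟨e, he⟩, ⟨k, hk⟩⟩)
  refine ⟨φ, fun i d h => ?_, fun i j d hi hj e he => funext fun k => ?_⟩
  · rw [← Finset.sum_filter, Finset.sum_subtype (p := (· ∈ A1 G i)) _ (by simp)]
    funext k
    simpa [L] using congrFun (hφ i _ h) (Sum.inl k)
  · rcases (hC e e.2).2 i j he k with hk | hk
    · exact edge_coord i d hi e (by simp [he]) k hk
    · exact edge_coord j d hj e (by simp [he]) k hk

/-- **Theorem 2.** If the finite connected simple graph `G` admits a feasible CODE-FEAS-1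
assignment, then for any finite field `A`, with `r = |Ṽ|` and `l = |Ṽ| + |Ẽ|` there is a
Construction-1 `(r,l)`-code of capacity `1` all of whose encoding maps are `A`-linear;
in particular the sum of all sources can be computed at all terminals at rate
`|Ṽ|/(|Ṽ|+|Ẽ|)`. -/
theorem construction1_achievability {V : Type} [Fintype V] [DecidableEq V]
    (G : SimpleGraph V) [DecidableRel G.Adj] (hG : G.Connected)
    (hfeas : ∃ m : Sym2 V → V → ℕ, Feas1 G m)
    (A : Type) [Field A] [Fintype A] :
    ∃ φ : ∀ i : V, (↥(A1 G i) → (Fin (Fintype.card V) → A)) →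
        (Fin (1 * (Fintype.card V + G.edgeFinset.card)) → A),
      (∀ i : V, IsLinearMap A (φ i)) ∧
      IsCode1 G A (Fintype.card V) (Fintype.card V + G.edgeFinset.card) 1 φ := by
  classical
  obtain ⟨m, hm⟩ := hfeas
  obtain ⟨φ, hsum, hedge⟩ := exists_linear_encoders G m hm A
  have kernel {i : V} {x y : Src1 G → Fin (Fintype.card V) → A}
      (h : φ i (fun a => x a.1) = φ i (fun a => y a.1)) :
      φ i (fun a => (x - y) a.1) = 0 :=
    (map_sub (φ i) _ _).trans (sub_eq_zero.mpr h)
  have sum_eq {x y : Src1 G → Fin (Fintype.card V) → A} (h : ∑ s, (x - y) s = 0) :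
      ∑ s, x s = ∑ s, y s := by
    simpa [Finset.sum_sub_distrib, sub_eq_zero] using h
  refine ⟨fun i => φ i, fun i => (φ i).isLinear, fun i => ?_, fun i j hij => ?_, ?_⟩
  · have hf : Function.FactorsThrough
        (fun x : Src1 G → Fin (Fintype.card V) → A => ∑ s, x s)
        (fun x => (φ i (fun a => x a.1), fun a : ↥((A1 G i)ᶜ) => x a.1)) := by
      intro x y h
      obtain ⟨hi, hc⟩ := Prod.mk.inj h
      refine sum_eq ((Finset.sum_congr rfl fun s _ => ?_).trans (hsum i _ (kernel hi)))
      split_ifs with hs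
      · rfl
      · exact sub_eq_zero.mpr (congrFun hc ⟨s, hs⟩)
    obtain ⟨ψ, hψ⟩ := (Function.factorsThrough_iff _).mp hf
    exact ⟨fun u v => ψ (u, v), fun x => (congrFun hψ x).symm⟩
  · have hf : Function.FactorsThrough
        (fun x : Src1 G → Fin (Fintype.card V) → A => ∑ s, x s)
        (fun x => (φ i (fun a => x a.1), φ j (fun a => x a.1),
          fun a : ↥((A1 G i ∪ A1 G j)ᶜ) => x a.1)) := by
      intro x y h
      obtain ⟨hi, h'⟩ := Prod.mk.inj h
      obtain ⟨hj, hc⟩ := Prod.mk.inj h'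
      have hsplit : ∀ s, (x - y) s = (if s ∈ A1 G i then (x - y) s else 0) +
          (if s ∈ A1 G j then (x - y) s else 0) := by
        intro s
        by_cases hsi : s ∈ A1 G i <;> by_cases hsj : s ∈ A1 G j
        · have hs : (x - y) s = 0 := by
            rcases s with v | e
            · exact absurd ((show v = i from hsi).symm.trans hsj) hij.ne
            · exact hedge i j _ (kernel hi) (kernel hj) e
                ((Sym2.mem_and_mem_iff hij.ne).mp ⟨hsi, hsj⟩)
          simp only [hs, ite_self, add_zero]
        · simp only [hsi, hsj, if_true, if_false, add_zero]
        · simp only [hsi, hsj, if_true, if_false, zero_add]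
        · simp only [hsi, hsj, if_false, add_zero]
          exact sub_eq_zero.mpr (congrFun hc ⟨s, fun hs => hs.elim hsi hsj⟩)
      refine sum_eq ((Finset.sum_congr rfl fun s _ => hsplit s).trans ?_)
      rw [Finset.sum_add_distrib, hsum i _ (kernel hi), hsum j _ (kernel hj), add_zero]
    obtain ⟨ψ, hψ⟩ := (Function.factorsThrough_iff _).mp hf
    exact ⟨fun u v w => ψ (u, v, w), fun x => (congrFun hψ x).symm⟩
  · have hf : Function.FactorsThrough
        (fun x : Src1 G → Fin (Fintype.card V) → A => ∑ s, x s)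
        (fun x i => φ i (fun a => x a.1)) := by
      intro x y h
      have hker (i : V) := kernel (congrFun h i)
      have hE : ∀ e : G.edgeSet, (x - y) (Sum.inr e) = 0 := by
        rintro ⟨e, he⟩
        induction e using Sym2.ind with
        | _ a b => exact hedge a b _ (hker a) (hker b) _ rfl
      have hV : ∀ v : V, (x - y) (Sum.inl v) = 0 := by
        intro v
        refine Eq.trans ?_ (hsum v _ (hker v))
        rw [Finset.sum_eq_single (Sum.inl v)]
        · exact (if_pos (show Sum.inl v ∈ A1 G v from rfl)).symm
        · rintro (w | e) - hw
          · exact if_neg fun hmem => hw (congrArg Sum.inl hmem)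
          · rw [hE, ite_self]
        · exact fun hv => absurd (Finset.mem_univ _) hv
      exact sum_eq (Finset.sum_eq_zero fun s _ => s.rec hV hE)
    obtain ⟨ψ, hψ⟩ := (Function.factorsThrough_iff _).mp hf
    exact ⟨ψ, fun x => (congrFun hψ x).symm⟩
end

section
/- (Theorem 3) Let G̃ = (Ṽ, Ẽ) be a finite connected simple graph that is not a tree, let Cyc be a shortest cycle of G̃, suppose G̃ admits a feasible CODE-FEAS-2 assignment (with respect to Cyc), and let A be any finite field. Then with r = |Ṽ| and l = |Ṽ| + |Ẽ| + 1 there exists a Construction-2 (r,l)-code of capacity α = 1 in which every encoding map φ_i is A-linear; in particular, the sum of all sources (including the starred source) can be computed at all terminals at rate |Ṽ|/(|Ṽ|+|Ẽ|+1). -/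
/-- A feasible CODE-FEAS-2 assignment with respect to the cycle `c`. -/
def Feas2 {V : Type} [Fintype V] [DecidableEq V] (G : SimpleGraph V)
    [DecidableRel G.Adj] {v : V} (c : G.Walk v v) (m : Sym2 V → V → ℕ) : Prop :=
  (∀ i j : V, G.Adj i j → m s(i, j) i + m s(i, j) j = Fintype.card V) ∧
  (∀ i : V, ∑ e ∈ G.edgeFinset.filter (fun e => i ∈ e), m e i ≤ G.edgeFinset.card + 1) ∧
  (Fintype.card V ≤ ∑ i ∈ c.support.toFinset,
      (G.edgeFinset.card + 1 - ∑ e ∈ G.edgeFinset.filter (fun e => i ∈ e), m e i))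

open Finset in
/-- Items of a finite type can be distributed among the elements of `s` without exceeding
their capacities, provided the total capacity suffices. -/
theorem exists_distribution {K V : Type} [Fintype K] [DecidableEq V] (s : Finset V)
    (cap : V → ℕ) (h : Fintype.card K ≤ ∑ i ∈ s, cap i) :
    ∃ τ : K → V, (∀ k, τ k ∈ s) ∧ ∀ i, #{k | τ k = i} ≤ cap i := by
  have hcard : Fintype.card K ≤ Fintype.card (Σ i : s, Fin (cap i)) := by
    simpa [Finset.sum_attach s cap] using h
  obtain ⟨f⟩ := Function.Embedding.nonempty_of_card_le hcard
  refine ⟨fun k => (f k).1, fun k => (f k).1.2, fun i => ?_⟩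
  have hcap : ∀ k ∈ ({k | ((f k).1 : V) = i} : Finset K), ((f k).2 : ℕ) ∈ range (cap i) := by
    intro k hk
    rw [mem_filter] at hk
    exact mem_range.2 ((f k).2.2.trans_eq (congrArg cap hk.2))
  refine (card_le_card_of_injOn (fun k => ((f k).2 : ℕ)) hcap ?_).trans_eq (card_range _)
  intro a ha b hb hab
  simp only [coe_filter, mem_univ, true_and, Set.mem_ofPred_eq] at ha hb
  have hfst : (f a).1 = (f b).1 := Subtype.ext (ha.trans hb.symm)
  refine f.injective (Sigma.ext hfst ?_)
  exact (Fin.heq_ext_iff (by rw [hfst])).2 hab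

/-- A finset with at most `l` elements is covered by the range of a map from `Fin l`. -/
theorem Finset.exists_fin_covering {K : Type} [Nonempty K] (s : Finset K) {l : ℕ}
    (h : s.card ≤ l) : ∃ g : Fin l → K, ∀ t ∈ s, ∃ b, g b = t := by
  have hcard : Fintype.card s ≤ Fintype.card (Fin l) := by simpa using h
  obtain ⟨f⟩ := Function.Embedding.nonempty_of_card_le hcard
  refine ⟨Function.extend f Subtype.val fun _ => Classical.arbitrary K, fun t ht => ?_⟩
  exact ⟨f ⟨t, ht⟩, f.injective.extend_apply _ _ ⟨t, ht⟩⟩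

theorem exists_decoder {X Y Z : Type} [Nonempty Z] (f : X → Y) (g : X → Z)
    (h : ∀ x y, f x = f y → g x = g y) : ∃ ψ : Y → Z, ∀ x, ψ (f x) = g x := by
  obtain ⟨ψ, hψ⟩ := (Function.factorsThrough_iff g).1 fun x y => h x y
  exact ⟨ψ, fun x => (congrFun hψ x).symm⟩

namespace Code2

variable {V : Type} (G : SimpleGraph V) {v : V} (c : G.Walk v v) {A : Type} [Field A]

/-- Labels of the code symbols: the coordinates of the local sum, of the edge symbols and of
the starred source. -/
abbrev Label (n : ℕ) : Type := Fin n ⊕ (↥G.edgeSet × Fin n) ⊕ Fin n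

open Classical in
/-- Extension by zero of a configuration of the sources in `A_i`. -/
noncomputable def extend {n : ℕ} (i : V) (z : ↥(A2 G c i) → Fin n → A) (s : Src2 G) :
    Fin n → A :=
  if h : s ∈ A2 G c i then z ⟨s, h⟩ else 0

variable {G c}

theorem extend_restrict_of_mem {n : ℕ} {i : V} {s : Src2 G} (h : s ∈ A2 G c i)
    (x : Src2 G → Fin n → A) : extend G c i (fun a => x a.1) s = x s := by
  simp [extend, h]

theorem extend_restrict_of_notMem {n : ℕ} {i : V} {s : Src2 G} (h : s ∉ A2 G c i)
    (x : Src2 G → Fin n → A) : extend G c i (fun a => x a.1) s = 0 := by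
  simp [extend, h]

theorem extend_add {n : ℕ} (i : V) (z z' : ↥(A2 G c i) → Fin n → A) :
    extend G c i (z + z') = extend G c i z + extend G c i z' := by
  funext s
  by_cases h : s ∈ A2 G c i <;> simp [extend, h]

theorem extend_smul {n : ℕ} (i : V) (a : A) (z : ↥(A2 G c i) → Fin n → A) :
    extend G c i (a • z) = a • extend G c i z := by
  funext s
  by_cases h : s ∈ A2 G c i <;> simp [extend, h]

variable [Fintype V] [DecidableEq V] [DecidableRel G.Adj]

variable (G c) in
open Classical in
/-- The code symbol with a given label. The symbol of an edge is its source, plus the starred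
source if both endpoints lie on the cycle. -/
noncomputable def symbol {n : ℕ} (d : Src2 G → Fin n → A) : Label G n → A
  | Sum.inl k => ∑ s, d s k
  | Sum.inr (Sum.inl (e, k)) => d (Sum.inr (Sum.inl e)) k +
      if ∀ a ∈ (e : Sym2 V), a ∈ c.support then d (Sum.inr (Sum.inr ())) k else 0
  | Sum.inr (Sum.inr k) => d (Sum.inr (Sum.inr ())) k

variable (G) in
open Classical in
/-- The labels of the symbols sent by vertex `i`, where `σ` and `τ` assign a sender to each
coordinate of each edge symbol and of the starred source. -/
noncomputable def labels {n : ℕ} (σ : ↥G.edgeSet → Fin n → V) (τ : Fin n → V) (i : V) :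
    Finset (Label G n) :=
  Finset.univ.disjSum ((Finset.univ.filter fun p : ↥G.edgeSet × Fin n => σ p.1 p.2 = i).disjSum
    (Finset.univ.filter fun k => τ k = i))

theorem symbol_add {n : ℕ} (d d' : Src2 G → Fin n → A) (t : Label G n) :
    symbol G c (d + d') t = symbol G c d t + symbol G c d' t := by
  rcases t with k | ⟨e, k⟩ | k
  · simp [symbol, Finset.sum_add_distrib]
  · simp only [symbol, Pi.add_apply]
    split_ifs <;> ring
  · simp [symbol]

theorem symbol_smul {n : ℕ} (a : A) (d : Src2 G → Fin n → A) (t : Label G n) :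
    symbol G c (a • d) t = a * symbol G c d t := by
  rcases t with k | ⟨e, k⟩ | k
  · simp only [symbol, Pi.smul_apply, smul_eq_mul, Finset.mul_sum]
  · simp only [symbol, Pi.smul_apply, smul_eq_mul]
    split_ifs <;> ring
  · simp [symbol]

theorem isLinearMap_encode {n l : ℕ} (i : V) (g : Fin l → Label G n) :
    IsLinearMap A fun (z : ↥(A2 G c i) → Fin n → A) b => symbol G c (extend G c i z) (g b) where
  map_add z z' := by
    funext b
    simp [extend_add, symbol_add]
  map_smul a z := by
    funext b
    simp [extend_smul, symbol_smul]

theorem symbol_extend_edge {n : ℕ} {i : V} {e : ↥G.edgeSet} (h : i ∈ (e : Sym2 V))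
    (x : Src2 G → Fin n → A) (k : Fin n) :
    symbol G c (extend G c i fun a => x a.1) (Sum.inr (Sum.inl (e, k))) =
      symbol G c x (Sum.inr (Sum.inl (e, k))) := by
  simp only [symbol]
  rw [extend_restrict_of_mem (show Sum.inr (Sum.inl e) ∈ A2 G c i from h)]
  split_ifs with hcyc
  · rw [extend_restrict_of_mem (show Sum.inr (Sum.inr ()) ∈ A2 G c i from hcyc i h)]
  · rfl

theorem sum_eq_zero_of_vertex {n : ℕ} {i : V} {d : Src2 G → Fin n → A} {k : Fin n}
    (hd : ∀ s ∉ A2 G c i, d s = 0)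
    (hi : symbol G c (extend G c i fun a => d a.1) (Sum.inl k) = 0) : ∑ s, d s k = 0 := by
  rw [← hi]
  refine Finset.sum_congr rfl fun s _ => ?_
  by_cases h : s ∈ A2 G c i
  · rw [extend_restrict_of_mem h]
  · rw [extend_restrict_of_notMem h, hd s h]

theorem sum_eq_zero_of_edge {n : ℕ} {i j : V} (hij : G.Adj i j) {d : Src2 G → Fin n → A}
    {k : Fin n} (hd : ∀ s ∉ A2 G c i ∪ A2 G c j, d s = 0)
    (hi : symbol G c (extend G c i fun a => d a.1) (Sum.inl k) = 0)
    (hj : symbol G c (extend G c j fun a => d a.1) (Sum.inl k) = 0)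
    (he : symbol G c d (Sum.inr (Sum.inl (⟨s(i, j), hij⟩, k))) = 0) : ∑ s, d s k = 0 := by
  classical
  have hsplit : ∀ s, d s k = extend G c i (fun a => d a.1) s k
      + extend G c j (fun a => d a.1) s k
      - if s ∈ A2 G c i ∧ s ∈ A2 G c j then d s k else 0 := by
    intro s
    by_cases h₁ : s ∈ A2 G c i <;> by_cases h₂ : s ∈ A2 G c j
    · simp [extend, h₁, h₂]
    · simp [extend, h₁, h₂]
    · simp [extend, h₁, h₂]
    · have := congrFun (hd s (by simp [h₁, h₂])) k
      simp [extend, h₁, h₂, this]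
  have hinter : ∑ s, (if s ∈ A2 G c i ∧ s ∈ A2 G c j then d s k else 0) =
      symbol G c d (Sum.inr (Sum.inl (⟨s(i, j), hij⟩, k))) := by
    rw [Fintype.sum_sum_type, Fintype.sum_sum_type]
    have hv : ∀ a : V, ¬ (Sum.inl a ∈ A2 G c i ∧ Sum.inl a ∈ A2 G c j) :=
      fun a h => hij.ne ((show a = i from h.1).symm.trans h.2)
    have hedge : ∀ e : ↥G.edgeSet, (Sum.inr (Sum.inl e) ∈ A2 G c i ∧
        Sum.inr (Sum.inl e) ∈ A2 G c j) ↔ e = ⟨s(i, j), hij⟩ :=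
      fun e => (Sym2.mem_and_mem_iff hij.ne).trans
        (Subtype.ext_iff (a2 := ⟨s(i, j), hij⟩)).symm
    have hstar : (Sum.inr (Sum.inr ()) ∈ A2 G c i ∧ Sum.inr (Sum.inr ()) ∈ A2 G c j) ↔
        ∀ a ∈ s(i, j), a ∈ c.support := by
      simp only [Sym2.mem_iff, forall_eq_or_imp, forall_eq]
      rfl
    simp only [hv, hedge, hstar, symbol, Finset.univ_unique, Finset.sum_singleton,
      PUnit.default_eq_unit, Finset.sum_ite_eq', Finset.mem_univ, if_true, if_false,
      Finset.sum_const_zero, zero_add]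
  rw [Finset.sum_congr rfl fun s _ => hsplit s, Finset.sum_sub_distrib,
    Finset.sum_add_distrib, hinter, he]
  simp only [symbol] at hi hj
  rw [hi, hj]
  ring

theorem sum_eq_zero_of_star {n : ℕ} {d : Src2 G → Fin n → A} {k : Fin n}
    (hv : ∀ i, symbol G c (extend G c i fun a => d a.1) (Sum.inl k) = 0)
    (he : ∀ e, symbol G c d (Sum.inr (Sum.inl (e, k))) = 0)
    (hstar : d (Sum.inr (Sum.inr ())) k = 0) : ∑ s, d s k = 0 := by
  have hedge : ∀ e, d (Sum.inr (Sum.inl e)) k = 0 := fun e => by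
    simpa [symbol, hstar] using he e
  have hvertex : ∀ i, d (Sum.inl i) k = 0 := fun i => by
    rw [← hv i]
    simp only [symbol]
    rw [Finset.sum_eq_single (Sum.inl i)]
    · rw [extend_restrict_of_mem (show Sum.inl i ∈ A2 G c i from rfl)]
    · intro s _ hs
      by_cases h : s ∈ A2 G c i
      · rw [extend_restrict_of_mem h]
        rcases s with a | e | u
        · exact absurd (congrArg Sum.inl (show a = i from h)) hs
        · exact hedge e
        · exact hstar
      · rw [extend_restrict_of_notMem h]
        rfl
    · simp
  refine Finset.sum_eq_zero fun s _ => ?_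
  rcases s with a | e | u
  · exact hvertex a
  · exact hedge e
  · exact hstar

theorem card_labels_le {n : ℕ} {σ : ↥G.edgeSet → Fin n → V} {τ : Fin n → V} {i : V}
    {m : Sym2 V → V → ℕ} (hσ : ∀ (e : ↥G.edgeSet) k, σ e k ∈ (e : Sym2 V))
    (hσm : ∀ e : ↥G.edgeSet, (Finset.univ.filter fun k => σ e k = i).card ≤ m e i) {t : ℕ}
    (ht : (Finset.univ.filter fun k => τ k = i).card ≤ t) :
    (labels G σ τ i).card ≤ n + (∑ e ∈ G.edgeFinset.filter (fun e => i ∈ e), m e i + t) := by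
  classical
  have hedges : (Finset.univ.filter fun p : ↥G.edgeSet × Fin n => σ p.1 p.2 = i).card ≤
      ∑ e ∈ G.edgeFinset.filter (fun e => i ∈ e), m e i := by
    rw [Finset.card_filter, Fintype.sum_prod_type, Finset.sum_filter,
      Finset.sum_subtype G.edgeFinset (p := (· ∈ G.edgeSet)) fun e => SimpleGraph.mem_edgeFinset]
    refine Finset.sum_le_sum fun e _ => ?_
    rw [← Finset.card_filter]
    split_ifs with h
    · exact hσm e
    · rw [Finset.card_eq_zero.2]
      exact Finset.filter_eq_empty_iff.2 fun k _ hk => h (hk ▸ hσ e k)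
  unfold labels
  rw [Finset.card_disjSum, Finset.card_disjSum, Finset.card_univ, Fintype.card_fin]
  refine Nat.add_le_add_left (Nat.add_le_add ?_ ?_) n
  · convert hedges
  · convert ht

end Code2

/-- **Theorem 3.** If the finite connected simple graph `G` (not a tree, with shortest
cycle `c`) admits a feasible CODE-FEAS-2 assignment with respect to `c`, then for any
finite field `A`, with `r = |Ṽ|` and `l = |Ṽ| + |Ẽ| + 1` there is a Construction-2
`(r,l)`-code of capacity `1` all of whose encoding maps are `A`-linear; in particular
the sum of all sources (including the starred one) can be computed at all terminals at
rate `|Ṽ|/(|Ṽ|+|Ẽ|+1)`. -/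
theorem construction2_achievability {V : Type} [Fintype V] [DecidableEq V]
    (G : SimpleGraph V) [DecidableRel G.Adj] (hG : G.Connected) {v : V} (c : G.Walk v v)
    (hc : c.IsCycle) (hshort : c.length = G.girth)
    (hfeas : ∃ m : Sym2 V → V → ℕ, Feas2 G c m)
    (A : Type) [Field A] [Fintype A] :
    ∃ φ : ∀ i : V, (↥(A2 G c i) → (Fin (Fintype.card V) → A)) →
        (Fin (1 * (Fintype.card V + G.edgeFinset.card + 1)) → A),
      (∀ i : V, IsLinearMap A (φ i)) ∧
      IsCode2 G c A (Fintype.card V) (Fintype.card V + G.edgeFinset.card + 1) 1 φ := by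
  classical
  obtain ⟨m, hm, hcap, hstar⟩ := hfeas
  set n := Fintype.card V with hn
  have hdist : ∀ e : ↥G.edgeSet, ∃ σ : Fin n → V, (∀ k, σ k ∈ (e : Sym2 V)) ∧
      ∀ i, (Finset.univ.filter fun k => σ k = i).card ≤ m e i := by
    rintro ⟨e, he⟩
    induction e with | _ i j
    have hij : G.Adj i j := he
    obtain ⟨σ, hσ, hσm⟩ := exists_distribution (K := Fin n) {i, j} (m s(i, j))
      (by rw [Finset.sum_pair hij.ne, hm i j hij, Fintype.card_fin])
    exact ⟨σ, fun k => by simpa using hσ k, hσm⟩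
  choose σ hσ hσm using hdist
  obtain ⟨τ, hτ, hτm⟩ := exists_distribution (K := Fin n) _ _
    ((Fintype.card_fin n).trans_le hstar)
  have hlabels : ∀ i, (Code2.labels G σ τ i).card ≤ 1 * (n + G.edgeFinset.card + 1) := by
    intro i
    have h₁ := Code2.card_labels_le (τ := τ) hσ (fun e => hσm e i) (hτm i)
    have h₂ := hcap i
    omega
  have : Nonempty (Fin n) := Fin.pos_iff_nonempty.1 (Fintype.card_pos_iff.2 ⟨v⟩)
  choose g hg using fun i => (Code2.labels G σ τ i).exists_fin_covering (hlabels i)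
  let φ : ∀ i : V, (↥(A2 G c i) → (Fin n → A)) → (Fin (1 * (n + G.edgeFinset.card + 1)) → A) :=
    fun i z b => Code2.symbol G c (Code2.extend G c i z) (g i b)
  have hlin : ∀ i, IsLinearMap A (φ i) := fun i => Code2.isLinearMap_encode i (g i)
  have hsymbol : ∀ i (x y : Src2 G → Fin n → A),
      φ i (fun a => x a.1) = φ i (fun a => y a.1) → ∀ t ∈ Code2.labels G σ τ i,
        Code2.symbol G c (Code2.extend G c i fun a => (x - y) a.1) t = 0 := by
    intro i x y hxy t ht
    obtain ⟨b, rfl⟩ := hg i t ht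
    have := congrFun ((hlin i).map_sub (fun a => x a.1) (fun a => y a.1)) b
    rw [hxy, sub_self] at this
    exact this
  have hlocal : ∀ i k, Sum.inl k ∈ Code2.labels G σ τ i := fun i k => by simp [Code2.labels]
  have hedge : ∀ e k, Sum.inr (Sum.inl (e, k)) ∈ Code2.labels G σ τ (σ e k) := fun e k => by
    simp [Code2.labels]
  have hstarred : ∀ k, Sum.inr (Sum.inr k) ∈ Code2.labels G σ τ (τ k) := fun k => by
    simp [Code2.labels]
  have hsum : ∀ x y : Src2 G → Fin n → A, (∀ k, ∑ s, (x - y) s k = 0) →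
      ∑ s, x s = ∑ s, y s := by
    intro x y h
    funext k
    have := h k
    simp only [Pi.sub_apply, Finset.sum_sub_distrib] at this
    simpa using sub_eq_zero.1 this
  refine ⟨φ, hlin, fun i => ?_, fun i j hij => ?_, ?_⟩
  · obtain ⟨ψ, hψ⟩ := exists_decoder
      (fun x : Src2 G → Fin n → A => (φ i (fun a => x a.1), fun a : ↥(A2 G c i)ᶜ => x a.1))
      (fun x => ∑ s, x s) (by
        intro x y h
        obtain ⟨hi, hoff⟩ := Prod.mk.inj h
        refine hsum x y fun k => Code2.sum_eq_zero_of_vertex (fun s hs => ?_)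
          (hsymbol i x y hi _ (hlocal i k))
        exact sub_eq_zero.2 (congrFun hoff ⟨s, hs⟩))
    exact ⟨fun p q => ψ (p, q), hψ⟩
  · obtain ⟨ψ, hψ⟩ := exists_decoder
      (fun x : Src2 G → Fin n → A => (φ i (fun a => x a.1), φ j (fun a => x a.1),
        fun a : ↥(A2 G c i ∪ A2 G c j)ᶜ => x a.1))
      (fun x => ∑ s, x s) (by
        intro x y h
        obtain ⟨hi, h⟩ := Prod.mk.inj h
        obtain ⟨hj, hoff⟩ := Prod.mk.inj h
        refine hsum x y fun k => Code2.sum_eq_zero_of_edge hij (fun s hs => ?_)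
          (hsymbol i x y hi _ (hlocal i k)) (hsymbol j x y hj _ (hlocal j k)) ?_
        · exact sub_eq_zero.2 (congrFun hoff ⟨s, hs⟩)
        · rw [← Code2.symbol_extend_edge (hσ ⟨s(i, j), hij⟩ k)]
          refine hsymbol _ x y ?_ _ (hedge _ k)
          rcases Sym2.mem_iff.1 (hσ ⟨s(i, j), hij⟩ k) with h' | h' <;> rw [h'] <;> assumption)
    exact ⟨fun p q w => ψ (p, q, w), hψ⟩
  · refine exists_decoder (fun (x : Src2 G → Fin n → A) i => φ i (fun a => x a.1)) _ ?_
    intro x y h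
    have hall := fun i => hsymbol i x y (congrFun h i)
    refine hsum x y fun k => Code2.sum_eq_zero_of_star (fun i => hall i _ (hlocal i k))
      (fun e => ?_) ?_
    · rw [← Code2.symbol_extend_edge (hσ e k)]
      exact hall _ _ (hedge e k)
    · have := hall _ _ (hstarred k)
      simp only [Code2.symbol] at this
      rwa [Code2.extend_restrict_of_mem
        (show Sum.inr (Sum.inr ()) ∈ A2 G c (τ k) from List.mem_toFinset.1 (hτ k))] at this
end
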